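/- (Signature of the theta divisor / Euler characteristic of the Tomei manifold, formula (tau).) For every even natural number n: ∑_{k=0}^{n} (−1)^k · A(n+1,k) = (2^{n+2}·(2^{n+2}−1)/(n+2)) · B_{n+2}, as an identity of rational numbers, where B_m is the m-th Bernoulli number. -/

import Mathlib

/-- Number of descents of a permutation of `Fin (m+1)`: indices `i ≤ m-1` with `σ i > σ (i+1)`. -/
def descentCount {m : ℕ} (σ : Equiv.Perm (Fin (m + 1))) : ℕ :=
  (Finset.univ.filter fun i : Fin m => σ i.succ < σ i.castSucc).card

/-- The Eulerian number `A(n,k)`: number of permutations of `Fin n` with exactly `k` descents. -/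
def eulerian (n k : ℕ) : ℕ :=
  match n with
  | 0 => if k = 0 then 1 else 0
  | m + 1 => Fintype.card {σ : Equiv.Perm (Fin (m + 1)) // descentCount σ = k}

/-- The word of `σ` with a new largest letter inserted at position `p`. -/
def insertMax {n : ℕ} (p : Fin (n + 1)) (σ : Equiv.Perm (Fin n)) : Equiv.Perm (Fin (n + 1)) :=
  ((finSuccEquiv' p).trans (Equiv.optionCongr σ)).trans finSuccEquivLast.symm

@[simp]
theorem insertMax_self {n : ℕ} (p : Fin (n + 1)) (σ : Equiv.Perm (Fin n)) :
    insertMax p σ p = Fin.last n := by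
  simp [insertMax]

@[simp]
theorem insertMax_succAbove {n : ℕ} (p : Fin (n + 1)) (σ : Equiv.Perm (Fin n)) (i : Fin n) :
    insertMax p σ (p.succAbove i) = (σ i).castSucc := by
  simp [insertMax]

theorem insertMax_bijective (n : ℕ) :
    Function.Bijective fun x : Fin (n + 1) × Equiv.Perm (Fin n) => insertMax x.1 x.2 := by
  rw [Fintype.bijective_iff_injective_and_card]
  refine ⟨?_, by simp [Fintype.card_perm, Nat.factorial_succ]⟩
  rintro ⟨p, σ⟩ ⟨q, τ⟩ h
  dsimp only at h
  obtain rfl : p = q := by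
    apply (insertMax q τ).injective
    rw [insertMax_self, ← h, insertMax_self]
  obtain rfl : σ = τ := by
    ext i
    have := congrArg (fun ρ => ρ (p.succAbove i)) h
    simpa [Fin.ext_iff] using this
  rfl

theorem descentCount_eq_sum {m : ℕ} (σ : Equiv.Perm (Fin (m + 1))) :
    descentCount σ = ∑ i : Fin m, if σ i.succ < σ i.castSucc then 1 else 0 := by
  simp [descentCount]

theorem descentCount_le {m : ℕ} (σ : Equiv.Perm (Fin (m + 1))) : descentCount σ ≤ m :=
  (Finset.card_filter_le _ _).trans (by simp)

theorem descentCount_insertMax_last {m : ℕ} (σ : Equiv.Perm (Fin (m + 1))) :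
    descentCount (insertMax (Fin.last (m + 1)) σ) = descentCount σ := by
  have h (i : Fin (m + 1)) : insertMax (Fin.last (m + 1)) σ i.castSucc = (σ i).castSucc := by
    simpa using insertMax_succAbove (Fin.last (m + 1)) σ i
  have hl := insertMax_self (Fin.last (m + 1)) σ
  rw [descentCount_eq_sum, descentCount_eq_sum, Fin.sum_univ_castSucc]
  simp only [Fin.succ_last, hl, Fin.succ_castSucc, h, Fin.castSucc_lt_castSucc_iff]
  simp [Fin.le_last]

theorem descentCount_insertMax_castSucc {m : ℕ} (σ : Equiv.Perm (Fin (m + 1)))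
    (q : Fin (m + 1)) :
    descentCount (insertMax q.castSucc σ) =
      1 + ∑ j : Fin m, if q = j.succ then 0 else if σ j.succ < σ j.castSucc then 1 else 0 := by
  rw [descentCount_eq_sum, Fin.sum_univ_succAbove _ q]
  congr 1
  · have : q.succ = q.castSucc.succAbove q := by simp
    rw [this, insertMax_succAbove, insertMax_self, if_pos (Fin.castSucc_lt_last _)]
  · refine Finset.sum_congr rfl fun j _ => ?_
    by_cases hq : q = j.succ
    · subst hq
      have h1 : (j.succ.succAbove j).succ = j.succ.castSucc := by ext; simp
      rw [h1, insertMax_self, if_pos rfl, if_neg (Fin.le_last _).not_gt]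
    · have h1 : (q.succAbove j).castSucc = q.castSucc.succAbove j.castSucc := by
        simp only [Fin.ext_iff, Fin.succAbove, Fin.lt_def, Fin.val_castSucc]
        split_ifs <;> simp
      have h2 : (q.succAbove j).succ = q.castSucc.succAbove j.succ := by
        simp only [Fin.ext_iff, Fin.succAbove, Fin.lt_def, Fin.val_castSucc, Fin.val_succ] at *
        split_ifs <;> simp <;> omega
      rw [h1, h2, insertMax_succAbove, insertMax_succAbove, if_neg hq]
      simp only [Fin.castSucc_lt_castSucc_iff]

theorem sum_insertMax {M : Type*} [AddCommMonoid M] {m : ℕ} (σ : Equiv.Perm (Fin (m + 1)))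
    (f : ℕ → M) :
    ∑ p, f (descentCount (insertMax p σ)) =
      (descentCount σ + 1) • f (descentCount σ) +
        (m - descentCount σ + 1) • f (descentCount σ + 1) := by
  have h0 : descentCount (insertMax (Fin.castSucc 0) σ) = descentCount σ + 1 := by
    rw [descentCount_insertMax_castSucc, descentCount_eq_sum, add_comm]
    simp [(Fin.succ_ne_zero _).symm]
  have hs (j : Fin m) : f (descentCount (insertMax j.succ.castSucc σ)) =
      if σ j.succ < σ j.castSucc then f (descentCount σ) else f (descentCount σ + 1) := by
    have h : descentCount (insertMax j.succ.castSucc σ) +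
        (if σ j.succ < σ j.castSucc then 1 else 0) = descentCount σ + 1 := by
      rw [descentCount_insertMax_castSucc, descentCount_eq_sum,
        ← Finset.add_sum_erase _ _ (Finset.mem_univ j),
        ← Finset.add_sum_erase (a := j) _ (fun j => if σ j.succ < σ j.castSucc then 1 else 0)
          (Finset.mem_univ j)]
      have : ∑ i ∈ Finset.univ.erase j, (if j.succ = i.succ then 0 else
          if σ i.succ < σ i.castSucc then 1 else 0) =
          ∑ i ∈ Finset.univ.erase j, if σ i.succ < σ i.castSucc then 1 else 0 := by
        refine Finset.sum_congr rfl fun i hi => if_neg ?_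
        simpa [eq_comm] using hi
      rw [this]
      simp only [if_true]
      ring
    split_ifs at h ⊢
    · rw [Nat.add_right_cancel h]
    · rw [← h, add_zero]
  have hc : (Finset.univ.filter fun i : Fin m => ¬ σ i.succ < σ i.castSucc).card =
      m - descentCount σ := by
    have := Finset.card_filter_add_card_filter_not (s := Finset.univ)
      fun i : Fin m => σ i.succ < σ i.castSucc
    rw [Finset.card_univ, Fintype.card_fin] at this
    rw [descentCount]
    omega
  rw [Fin.sum_univ_castSucc, Fin.sum_univ_succ, descentCount_insertMax_last, h0]
  simp only [hs]
  rw [Finset.sum_ite, Finset.sum_const, Finset.sum_const, hc, ← descentCount, add_smul, add_smul,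
    one_smul, one_smul]
  abel

theorem sum_perm_succ {M : Type*} [AddCommMonoid M] (m : ℕ) (f : ℕ → M) :
    ∑ τ : Equiv.Perm (Fin (m + 2)), f (descentCount τ) =
      ∑ σ : Equiv.Perm (Fin (m + 1)), ((descentCount σ + 1) • f (descentCount σ) +
        (m - descentCount σ + 1) • f (descentCount σ + 1)) := by
  rw [← Fintype.sum_bijective _ (insertMax_bijective (m + 1))
    (fun x => f (descentCount (insertMax x.1 x.2))) _ fun _ => rfl, Fintype.sum_prod_type_right]
  exact Finset.sum_congr rfl fun σ _ => sum_insertMax σ f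

/-- If `D a = D d = a * d`, then iterating `D` on `a` yields the homogeneous Eulerian polynomials
in `a` and `d`. -/
theorem Derivation.iterate_eq_sum_descentCount {R A : Type*} [CommSemiring R] [CommSemiring A]
    [Algebra R A] (D : Derivation R A A) {a d : A} (ha : D a = a * d) (hd : D d = a * d) (m : ℕ) :
    D^[m + 1] a = ∑ σ : Equiv.Perm (Fin (m + 1)),
      a ^ (m - descentCount σ + 1) * d ^ (descentCount σ + 1) := by
  induction m with
  | zero => simp [ha, descentCount]
  | succ m ih =>
    rw [Function.iterate_succ_apply', ih, map_sum,
      sum_perm_succ m fun k => a ^ (m + 1 - k + 1) * d ^ (k + 1)]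
    refine Finset.sum_congr rfl fun σ _ => ?_
    have h1 : m + 1 - descentCount σ = m - descentCount σ + 1 := by
      have := descentCount_le σ
      omega
    have h2 : m + 1 - (descentCount σ + 1) = m - descentCount σ := by omega
    simp only [D.leibniz, D.leibniz_pow, ha, hd, h1, h2, smul_eq_mul, nsmul_eq_mul,
      Nat.add_sub_cancel]
    ring

open PowerSeries in
/-- The formal power series `tanh`, as `1 - 2 / (exp (2 X) + 1)`. -/
noncomputable def tanhSeries : ℚ⟦X⟧ := 1 - 2 * (exp ℚ ^ 2 + 1)⁻¹

open PowerSeries in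
theorem exp_sq_add_one_mul_inv : (exp ℚ ^ 2 + 1) * (exp ℚ ^ 2 + 1)⁻¹ = 1 :=
  PowerSeries.mul_inv_cancel _ (by simp)

open PowerSeries in
theorem constantCoeff_tanhSeries : constantCoeff tanhSeries = 0 := by
  have h := congrArg constantCoeff (map_ofNat (C (R := ℚ)) 2)
  rw [constantCoeff_C] at h
  simp [tanhSeries, constantCoeff_inv, ← h]
  norm_num

open PowerSeries in
theorem derivative_tanhSeries : d⁄dX ℚ tanhSeries = 1 - tanhSeries ^ 2 := by
  have h := exp_sq_add_one_mul_inv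
  have h2 : d⁄dX ℚ (2 : ℚ⟦X⟧) = 0 := by exact_mod_cast (d⁄dX ℚ).map_natCast 2
  simp only [tanhSeries, map_sub, map_add, Derivation.leibniz, Derivation.leibniz_pow,
    Derivation.map_one_eq_zero, derivative_inv', derivative_exp, smul_eq_mul, nsmul_eq_mul, h2]
  generalize (exp ℚ ^ 2 + 1)⁻¹ = u at *
  push_cast
  linear_combination 4 * u * h

open PowerSeries in
theorem X_mul_tanhSeries : X * tanhSeries =
    X - rescale 2 (bernoulliPowerSeries ℚ) + rescale 4 (bernoulliPowerSeries ℚ) := by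
  have hE (k : ℕ) : rescale (k : ℚ) (bernoulliPowerSeries ℚ) * (exp ℚ ^ k - 1) = (k : ℚ⟦X⟧) * X := by
    have := congrArg (rescale (k : ℚ)) (bernoulliPowerSeries_mul_exp_sub_one ℚ)
    rw [map_mul, map_sub, map_one, ← exp_pow_eq_rescale_exp, rescale_X] at this
    simpa using this
  have h2 := hE 2
  have h4 := hE 4
  have h := exp_sq_add_one_mul_inv
  have hne : exp ℚ ^ 2 - 1 ≠ 0 := by
    intro h0
    have := congrArg (coeff 1) h0
    rw [exp_pow_eq_rescale_exp] at this
    simp [coeff_one] at this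
  apply mul_right_cancel₀ hne
  push_cast at h2 h4
  rw [tanhSeries]
  generalize (exp ℚ ^ 2 + 1)⁻¹ = u at *
  linear_combination h2 - u * h4 + (exp ℚ ^ 2 - 1) * (rescale 4 (bernoulliPowerSeries ℚ)) * h -
    2 * X * h

open PowerSeries in
theorem coeff_tanhSeries (n : ℕ) : coeff (n + 1) tanhSeries =
    2 ^ (n + 2) * (2 ^ (n + 2) - 1) * bernoulli (n + 2) / (n + 2).factorial := by
  have h := congrArg (coeff (n + 2)) X_mul_tanhSeries
  rw [coeff_succ_X_mul] at h
  have h4 : (4 : ℚ) ^ (n + 2) = 2 ^ (n + 2) * 2 ^ (n + 2) := by rw [← mul_pow]; norm_num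
  rw [h, map_add, map_sub, coeff_rescale, coeff_rescale, coeff_X, if_neg (by omega), h4]
  simp only [bernoulliPowerSeries, coeff_mk, eq_ratCast, Rat.cast_id]
  ring

open PowerSeries in
theorem sum_neg_one_pow_descentCount (m : ℕ) :
    ∑ σ : Equiv.Perm (Fin (m + 1)), (-1 : ℚ) ^ descentCount σ =
      (m + 1).factorial * coeff (m + 1) tanhSeries := by
  have hT := derivative_tanhSeries
  have h := (d⁄dX ℚ).iterate_eq_sum_descentCount (a := 1 - tanhSeries) (d := -(1 + tanhSeries))
    (by simp only [map_sub, Derivation.map_one_eq_zero, hT]; ring)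
    (by simp only [map_neg, map_add, Derivation.map_one_eq_zero, hT]; ring) m
  have h' := congrArg constantCoeff h
  rw [constantCoeff_iterate_derivative] at h'
  simp only [map_sum, map_mul, map_pow, map_sub, map_neg, map_add, constantCoeff_tanhSeries,
    map_one, coeff_one] at h'
  simp [pow_succ] at h'
  linarith

theorem sum_neg_one_pow_mul_eulerian (n : ℕ) :
    ∑ k ∈ Finset.range (n + 1), (-1 : ℚ) ^ k * (eulerian (n + 1) k : ℚ) =
      ∑ σ : Equiv.Perm (Fin (n + 1)), (-1 : ℚ) ^ descentCount σ := by
  rw [← Finset.sum_fiberwise_of_maps_to (t := Finset.range (n + 1)) (g := descentCount)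
    fun σ _ => Finset.mem_range_succ_iff.2 (descentCount_le σ)]
  refine Finset.sum_congr rfl fun k _ => ?_
  rw [Finset.sum_congr rfl fun σ hσ => by rw [(Finset.mem_filter.1 hσ).2], Finset.sum_const,
    nsmul_eq_mul, mul_comm, eulerian, Fintype.card_subtype]

/-- Signature of the theta divisor `Θ^n` (equivalently, Euler characteristic of the Tomei
manifold): for even `n`,
`∑_{k=0}^n (-1)^k A(n+1,k) = (2^{n+2}(2^{n+2}-1)/(n+2))·B_{n+2}` in `ℚ`. -/
theorem signature_theta_eq_bernoulli (n : ℕ) (hn : Even n) :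
    ∑ k ∈ Finset.range (n + 1), (-1 : ℚ) ^ k * (eulerian (n + 1) k : ℚ) =
      2 ^ (n + 2) * (2 ^ (n + 2) - 1) / (n + 2) * bernoulli (n + 2) := by
  rw [sum_neg_one_pow_mul_eulerian, sum_neg_one_pow_descentCount, coeff_tanhSeries,
    Nat.factorial_succ (n + 1)]
  have := (n + 1).factorial_ne_zero
  push_cast
  field_simp
  ring
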